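/- There exists an absolute constant C > 0 such that for every fixed subset J ⊆ {1,…,n}: E[ ‖h‖⁻² ‖h̃‖⁻² ( rᵀ L_J r̃ + Σ_{i∈J} Σ_{j=1}^{q} ∂(r_i h̃_j)/∂z_{ij} )² ] ≤ C ( |J| + E[ ‖L_J Z‖_op² (1 + Ξ_J + Ξ̃_J) ] ). -/

import Mathlib

open MeasureTheory ProbabilityTheory Matrix
open scoped ENNReal NNReal

noncomputable section

/-- Law of an `n × q` array with i.i.d. standard Gaussian entries. -/
def stdGaussMat (n q : ℕ) : Measure (Fin n → Fin q → ℝ) :=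
  Measure.pi fun _ => Measure.pi fun _ => gaussianReal 0 1

/-- ℓ₂→ℓ₂ operator norm of a real matrix. -/
def matOpNorm {a b : ℕ} (A : Matrix (Fin a) (Fin b) ℝ) : ℝ :=
  ‖LinearMap.toContinuousLinearMap (Matrix.toEuclideanLin A)‖

section GaussianTypeWeight

open Filter Topology
open scoped Convolution

variable {E : Type*} [NormedAddCommGroup E] [NormedSpace ℝ E] [FiniteDimensional ℝ E]
  [MeasurableSpace E] [BorelSpace E] {μ : Measure E} [μ.IsAddHaarMeasure]

omit [FiniteDimensional ℝ E] [MeasurableSpace E] [BorelSpace E] in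
lemma LipschitzWith.abs_fderiv_apply_le {f : E → ℝ} {C : ℝ≥0} (hf : LipschitzWith C f) (z v : E) :
    |fderiv ℝ f z v| ≤ C * ‖v‖ :=
  ((fderiv ℝ f z).le_opNorm v).trans (by gcongr; exact norm_fderiv_le_of_lipschitz ℝ hf)

omit [FiniteDimensional ℝ E] [μ.IsAddHaarMeasure] in
lemma MeasureTheory.Integrable.mul_fderiv_of_lipschitz {f k : E → ℝ} {C : ℝ≥0}
    (hf : LipschitzWith C f) (hk : Integrable k μ) (v : E) :
    Integrable (fun z => k z * fderiv ℝ f z v) μ :=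
  hk.mul_bdd (c := C * ‖v‖) (measurable_fderiv_apply_const ℝ f v).aestronglyMeasurable
    (ae_of_all _ fun z => hf.abs_fderiv_apply_le z v)

lemma LipschitzWith.hasFDerivAt_convolution {f φ : E → ℝ} {C : ℝ≥0} (hf : LipschitzWith C f)
    (hφ : Continuous φ) (hφc : HasCompactSupport φ) (x : E) :
    HasFDerivAt (φ ⋆[ContinuousLinearMap.lsmul ℝ ℝ, μ] f)
      ((φ ⋆[ContinuousLinearMap.lsmul ℝ ℝ, μ] fderiv ℝ f) x) x := by
  refine (hasFDerivAt_integral_of_dominated_loc_of_lip (s := Set.univ) (μ := μ)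
    (F := fun x t => φ t • f (x - t)) (F' := fun t => φ t • fderiv ℝ f (x - t))
    (bound := fun t => C * φ t) univ_mem ?_ ?_ ?_ ?_ ?_ ?_).2
  · refine Eventually.of_forall fun y => Continuous.aestronglyMeasurable ?_
    have := hf.continuous
    fun_prop
  · refine Continuous.integrable_of_hasCompactSupport ?_ hφc.smul_right
    have := hf.continuous
    fun_prop
  · refine hφ.aestronglyMeasurable.smul (Measurable.aestronglyMeasurable ?_)
    exact (measurable_fderiv ℝ f).comp (measurable_const.sub measurable_id)
  · refine ae_of_all _ fun t => LipschitzOnWith.of_dist_le_mul fun y _ z _ => ?_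
    simp only [smul_eq_mul, Real.dist_eq, ← mul_sub, abs_mul, Real.coe_nnabs, NNReal.abs_eq]
    have := hf.dist_le_mul (y - t) (z - t)
    rw [dist_sub_right, Real.dist_eq] at this
    calc |φ t| * |f (y - t) - f (z - t)| ≤ |φ t| * (C * dist y z) := by gcongr
      _ = _ := by ring
  · exact (hφ.integrable_of_hasCompactSupport hφc).const_mul _
  · have h1 := hf.ae_differentiableAt (μ := μ)
    have h2 := (Measure.measurePreserving_sub_left μ x).quasiMeasurePreserving.ae h1
    filter_upwards [h2] with t ht
    have := (ht.hasFDerivAt.comp x ((hasFDerivAt_id x).sub_const t)).const_smul (φ t)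
    exact this

/-- Integration by parts against a weight `w` with `∂_v w = -ℓ w`. -/
lemma integral_mul_stein_eq {w φ g : E → ℝ} {C : ℝ≥0} (hw : ContDiff ℝ 1 w) {v : E}
    {l : E →L[ℝ] ℝ} (hwv : ∀ z, fderiv ℝ w z v = -(l z * w z)) (hφ : ContDiff ℝ 1 φ)
    (hφc : HasCompactSupport φ) (hg : LipschitzWith C g) :
    ∫ z, φ z * (l z * g z - fderiv ℝ g z v) * w z ∂μ = ∫ z, fderiv ℝ φ z v * g z * w z ∂μ := by
  have hgc := hg.continuous
  have hwc := hw.continuous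
  have hφct := hφ.continuous
  have hdφ : Continuous fun z => fderiv ℝ φ z v :=
    (hφ.continuous_fderiv one_ne_zero).clm_apply continuous_const
  have hdφc : HasCompactSupport fun z => fderiv ℝ φ z v := hφc.fderiv_apply ℝ v
  obtain ⟨D, hD⟩ := ContDiff.lipschitzWith_of_hasCompactSupport (f := fun z => φ z * w z)
    hφc.mul_right (hφ.mul hw) one_ne_zero
  have key := LipschitzWith.integral_lineDeriv_mul_eq (μ := μ) hg hD hφc.mul_right v
  have hdiff := hg.ae_differentiableAt (μ := μ)
  have e1 : ∫ z, lineDeriv ℝ g z v * (φ z * w z) ∂μ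
      = ∫ z, (φ z * w z) * fderiv ℝ g z v ∂μ := by
    refine integral_congr_ae ?_
    filter_upwards [hdiff] with z hz
    rw [hz.lineDeriv_eq_fderiv, mul_comm]
  have e2 : ∀ z, lineDeriv ℝ (fun z => φ z * w z) z (-v) * g z
      = (φ z * w z) * (l z * g z) - fderiv ℝ φ z v * g z * w z := by
    intro z
    have h1 := (hφ.differentiable one_ne_zero z).hasFDerivAt
    have h2 := (hw.differentiable one_ne_zero z).hasFDerivAt
    have h3 : HasFDerivAt (fun z => φ z * w z) _ z := h1.mul h2
    rw [h3.differentiableAt.lineDeriv_eq_fderiv, h3.fderiv]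
    simp [hwv]
    ring
  have i1 : Integrable (fun z => (φ z * w z) * (l z * g z)) μ :=
    Continuous.integrable_of_hasCompactSupport (by fun_prop) hφc.mul_right.mul_right
  have i2 : Integrable (fun z => fderiv ℝ φ z v * g z * w z) μ :=
    Continuous.integrable_of_hasCompactSupport (by fun_prop) hdφc.mul_right.mul_right
  have i3 : Integrable (fun z => (φ z * w z) * fderiv ℝ g z v) μ :=
    Integrable.mul_fderiv_of_lipschitz hg
      (Continuous.integrable_of_hasCompactSupport (by fun_prop) hφc.mul_right) v
  simp_rw [e2] at key
  rw [e1, integral_sub i1 i2] at key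
  calc _ = ∫ z, (φ z * w z) * (l z * g z) - (φ z * w z) * fderiv ℝ g z v ∂μ := by
        congr 1; ext z; ring
    _ = _ := by rw [integral_sub i1 i3]; linarith

lemma integral_stein_mul_stein_of_contDiff {w f g : E → ℝ} {C : ℝ≥0} (hw : ContDiff ℝ 1 w)
    {v v' : E} {l l' : E →L[ℝ] ℝ} (hv : ∀ z, fderiv ℝ w z v = -(l z * w z))
    (hv' : ∀ z, fderiv ℝ w z v' = -(l' z * w z)) (hf : ContDiff ℝ 2 f)
    (hfc : HasCompactSupport f) (hg : LipschitzWith C g) :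
    ∫ z, (l z * f z - fderiv ℝ f z v) * (l' z * g z - fderiv ℝ g z v') * w z ∂μ
      = ∫ z, (l v' * (f z * g z) + fderiv ℝ f z v' * fderiv ℝ g z v) * w z ∂μ := by
  have hd : ∀ u : E, ContDiff ℝ 1 fun z => fderiv ℝ f z u := fun u =>
    (hf.fderiv_right (m := 1) (by norm_num)).clm_apply contDiff_const
  have hdc : ∀ u : E, HasCompactSupport fun z => fderiv ℝ f z u := fun u => hfc.fderiv_apply ℝ u
  have hf1 : ContDiff ℝ 1 f := hf.of_le (by norm_num)
  have hφ : ContDiff ℝ 1 fun z => l z * f z - fderiv ℝ f z v :=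
    (l.contDiff.mul hf1).sub (hd v)
  have hφc : HasCompactSupport fun z => l z * f z - fderiv ℝ f z v :=
    hfc.mul_left.sub (hdc v)
  rw [integral_mul_stein_eq hw hv' hφ hφc hg]
  have symm : ∀ z, fderiv ℝ (fun y => fderiv ℝ f y v) z v' = fderiv ℝ (fun y => fderiv ℝ f y v') z v := by
    intro z
    have h1 : DifferentiableAt ℝ (fderiv ℝ f) z :=
      ((hf.fderiv_right (m := 1) (by norm_num)).differentiable one_ne_zero) z
    have h2 : IsSymmSndFDerivAt ℝ f z :=
      hf.contDiffAt.isSymmSndFDerivAt (by simp)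
    rw [fderiv_clm_apply h1 (differentiableAt_const _), fderiv_clm_apply h1 (differentiableAt_const _)]
    simpa using h2 v' v
  have e : ∀ z, fderiv ℝ (fun z => l z * f z - fderiv ℝ f z v) z v'
      = l v' * f z + (l z * fderiv ℝ f z v' - fderiv ℝ (fun y => fderiv ℝ f y v') z v) := by
    intro z
    have h1 := (hf1.differentiable one_ne_zero z).hasFDerivAt
    have h2 := ((hd v).differentiable one_ne_zero z).hasFDerivAt
    have h3 : HasFDerivAt (fun z => l z * f z - fderiv ℝ f z v) _ z :=
      (l.hasFDerivAt.mul h1).sub h2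
    rw [h3.fderiv]
    simp [← symm]
    ring
  have hgc := hg.continuous
  have hwc := hw.continuous
  have hfct := hf.continuous
  have hdct := fun u => (hd u).continuous
  have hddct : Continuous fun z => fderiv ℝ (fun y => fderiv ℝ f y v') z v :=
    ((hd v').continuous_fderiv one_ne_zero).clm_apply continuous_const
  have hddc : HasCompactSupport fun z => fderiv ℝ (fun y => fderiv ℝ f y v') z v :=
    (hdc v').fderiv_apply ℝ v
  have key := integral_mul_stein_eq (μ := μ) hw hv (hd v') (hdc v') hg
  have i1 : Integrable (fun z => l v' * f z * g z * w z) μ :=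
    Continuous.integrable_of_hasCompactSupport (by fun_prop) hfc.mul_left.mul_right.mul_right
  have i2 : Integrable (fun z => fderiv ℝ f z v' * (l z * g z) * w z) μ :=
    Continuous.integrable_of_hasCompactSupport (by fun_prop) (hdc v').mul_right.mul_right
  have i3 : Integrable (fun z => fderiv ℝ (fun y => fderiv ℝ f y v') z v * g z * w z) μ :=
    Continuous.integrable_of_hasCompactSupport (by fun_prop) hddc.mul_right.mul_right
  have i4 : Integrable (fun z => fderiv ℝ f z v' * w z * fderiv ℝ g z v) μ :=
    Integrable.mul_fderiv_of_lipschitz hg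
      (Continuous.integrable_of_hasCompactSupport (by fun_prop) (hdc v').mul_right) v
  have key' : ∫ z, fderiv ℝ f z v' * (l z * g z) * w z ∂μ
      - ∫ z, fderiv ℝ f z v' * w z * fderiv ℝ g z v ∂μ
      = ∫ z, fderiv ℝ (fun y => fderiv ℝ f y v') z v * g z * w z ∂μ := by
    rw [← integral_sub i2 i4, ← key]
    congr 1; ext z; ring
  calc _ = ∫ z, (l v' * f z * g z * w z + (fderiv ℝ f z v' * (l z * g z) * w z
        - fderiv ℝ (fun y => fderiv ℝ f y v') z v * g z * w z)) ∂μ := by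
        congr 1; ext z; rw [e]; ring
    _ = ∫ z, l v' * f z * g z * w z ∂μ + ∫ z, fderiv ℝ f z v' * w z * fderiv ℝ g z v ∂μ := by
        have := integral_add i1 (i2.sub i3)
        simp only [Pi.sub_apply] at this
        rw [this, integral_sub i2 i3]; linarith
    _ = _ := by
        rw [← integral_add i1 i4]; congr 1; ext z; ring

omit [FiniteDimensional ℝ E] in
lemma LipschitzWith.integrable_continuous_mul_fderiv {g p : E → ℝ} {C : ℝ≥0}
    (hg : LipschitzWith C g) (hgc : HasCompactSupport g) (hp : Continuous p) (v : E) :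
    Integrable (fun z => p z * fderiv ℝ g z v) μ := by
  refine (integrableOn_iff_integrable_of_support_subset (s := tsupport g) ?_).1
    (Integrable.mul_fderiv_of_lipschitz hg (hp.continuousOn.integrableOn_compact hgc) v)
  intro z hz
  by_contra h
  refine hz ?_
  simp [fderiv_of_notMem_tsupport ℝ h]

lemma ContDiffBump.norm_normed_convolution_le {G : Type*} [NormedAddCommGroup G]
    [NormedSpace ℝ G] (φ : ContDiffBump (0 : E)) {f : E → G} {M : ℝ} (hf : ∀ x, ‖f x‖ ≤ M) (x : E) :
    ‖(φ.normed μ ⋆[ContinuousLinearMap.lsmul ℝ ℝ, μ] f) x‖ ≤ M := by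
  have hi : Integrable (fun t => φ.normed μ t * M) μ := φ.integrable_normed.mul_const M
  calc _ ≤ ∫ t, φ.normed μ t * M ∂μ := by
        refine norm_integral_le_of_norm_le hi (ae_of_all _ fun t => ?_)
        simp only [ContinuousLinearMap.lsmul_apply, norm_smul]
        rw [Real.norm_of_nonneg (φ.nonneg_normed t)]
        exact mul_le_mul_of_nonneg_left (hf _) (φ.nonneg_normed t)
    _ = M := by rw [integral_mul_const, φ.integral_normed, one_mul]

lemma integral_stein_mul_stein {w f g : E → ℝ} {B C : ℝ≥0} (hw : ContDiff ℝ 1 w)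
    {v v' : E} {l l' : E →L[ℝ] ℝ} (hv : ∀ z, fderiv ℝ w z v = -(l z * w z))
    (hv' : ∀ z, fderiv ℝ w z v' = -(l' z * w z)) (hf : LipschitzWith B f)
    (hfc : HasCompactSupport f) (hg : LipschitzWith C g) (hgc : HasCompactSupport g) :
    ∫ z, (l z * f z - fderiv ℝ f z v) * (l' z * g z - fderiv ℝ g z v') * w z ∂μ
      = ∫ z, (l v' * (f z * g z) + fderiv ℝ f z v' * fderiv ℝ g z v) * w z ∂μ := by
  have hgct := hg.continuous
  have hwc := hw.continuous
  obtain ⟨M, hM⟩ := hfc.exists_bound_of_continuous hf.continuous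
  let φ : ℕ → ContDiffBump (0 : E) := fun k =>
    ⟨1 / (k + 1), 2 * (1 / (k + 1)), by positivity, by
      have : (0 : ℝ) < 1 / (k + 1) := by positivity
      linarith⟩
  have hφ : Tendsto (fun k => (φ k).rOut) atTop (𝓝 0) := by
    have := (tendsto_one_div_add_atTop_nhds_zero_nat (𝕜 := ℝ)).const_mul 2
    rwa [mul_zero] at this
  have hφ' : ∀ᶠ k in atTop, (φ k).rOut ≤ 2 * (φ k).rIn := Eventually.of_forall fun k => le_rfl
  have hfl : LocallyIntegrable f μ := hf.continuous.locallyIntegrable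
  have hdf : ∀ x, ‖fderiv ℝ f x‖ ≤ B := fun x => norm_fderiv_le_of_lipschitz ℝ hf
  have hdfl : LocallyIntegrable (fderiv ℝ f) μ :=
    (locallyIntegrable_const (B : ℝ)).mono (measurable_fderiv ℝ f).aestronglyMeasurable
      (ae_of_all _ fun x => by simpa using hdf x)
  let F : ℕ → E → ℝ := fun k => (φ k).normed μ ⋆[ContinuousLinearMap.lsmul ℝ ℝ, μ] f
  have hF : ∀ k, ContDiff ℝ 2 (F k) := fun k =>
    (φ k).hasCompactSupport_normed.contDiff_convolution_left (n := 2) _ (φ k).contDiff_normed hfl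
  have hFc : ∀ k, HasCompactSupport (F k) := fun k =>
    (φ k).hasCompactSupport_normed.convolution _ hfc
  have hFM : ∀ k x, |F k x| ≤ M := fun k x => (φ k).norm_normed_convolution_le hM x
  have hFd : ∀ k x, fderiv ℝ (F k) x
      = ((φ k).normed μ ⋆[ContinuousLinearMap.lsmul ℝ ℝ, μ] fderiv ℝ f) x := fun k x =>
    (hf.hasFDerivAt_convolution (φ k).continuous_normed (φ k).hasCompactSupport_normed x).fderiv
  have hFB : ∀ k x u, |fderiv ℝ (F k) x u| ≤ B * ‖u‖ := fun k x u => by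
    refine ((fderiv ℝ (F k) x).le_opNorm u).trans ?_
    gcongr
    rw [hFd]
    exact (φ k).norm_normed_convolution_le hdf x
  have lim : ∀ᵐ x ∂μ, Tendsto (fun k => F k x) atTop (𝓝 (f x)) :=
    ContDiffBump.ae_convolution_tendsto_right_of_locallyIntegrable hφ hφ' hfl
  have limd : ∀ᵐ x ∂μ, ∀ u, Tendsto (fun k => fderiv ℝ (F k) x u) atTop (𝓝 (fderiv ℝ f x u)) := by
    filter_upwards [ContDiffBump.ae_convolution_tendsto_right_of_locallyIntegrable hφ hφ' hdfl]
      with x hx u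
    simp_rw [hFd]
    exact ((ContinuousLinearMap.apply ℝ ℝ u).continuous.tendsto _).comp hx
  have hFmeas : ∀ k, Measurable (F k) := fun k => (hF k).continuous.measurable
  have hlm : ∀ m : E →L[ℝ] ℝ, Measurable m := fun m => m.continuous.measurable
  have hdm : ∀ (p : E → ℝ) (u : E), Measurable fun z => fderiv ℝ p z u := fun p u =>
    measurable_fderiv_apply_const ℝ p u
  have hgm := hgct.measurable
  have hwm := hwc.measurable
  have id_k := fun k => integral_stein_mul_stein_of_contDiff (μ := μ) hw hv hv' (hF k) (hFc k) hg
  have lhs : Tendsto (fun k => ∫ z, (l z * F k z - fderiv ℝ (F k) z v) *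
      (l' z * g z - fderiv ℝ g z v') * w z ∂μ) atTop
      (𝓝 (∫ z, (l z * f z - fderiv ℝ f z v) * (l' z * g z - fderiv ℝ g z v') * w z ∂μ)) := by
    refine tendsto_integral_of_dominated_convergence
      (fun z => ‖((|l z| * M + B * ‖v‖) * (l' z * g z) * w z
        - (|l z| * M + B * ‖v‖) * w z * fderiv ℝ g z v')‖) (fun k => ?_) ?_ (fun k => ?_) ?_
    · exact (((((hlm l).mul (hFmeas k)).sub (hdm _ _)).mul
        (((hlm l').mul hgm).sub (hdm _ _))).mul hwm).aestronglyMeasurable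
    · refine (Integrable.sub ?_ ?_).norm
      · exact Continuous.integrable_of_hasCompactSupport (by fun_prop)
          hgc.mul_left.mul_left.mul_right
      · exact hg.integrable_continuous_mul_fderiv hgc (by fun_prop) v'
    · refine ae_of_all _ fun z => ?_
      have h0 : |l z * F k z - fderiv ℝ (F k) z v| ≤ |l z| * M + B * ‖v‖ := by
        refine (abs_sub _ _).trans (add_le_add ?_ (hFB k z v))
        rw [abs_mul]
        exact mul_le_mul_of_nonneg_left (hFM k z) (abs_nonneg _)
      rw [mul_assoc, show (|l z| * M + B * ‖v‖) * (l' z * g z) * w z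
        - (|l z| * M + B * ‖v‖) * w z * fderiv ℝ g z v'
        = (|l z| * M + B * ‖v‖) * ((l' z * g z - fderiv ℝ g z v') * w z) by ring,
        norm_mul (_ - _), norm_mul (_ + _)]
      exact mul_le_mul_of_nonneg_right (h0.trans (le_abs_self _)) (norm_nonneg _)
    · filter_upwards [lim, limd] with z h1 h2
      exact (((h1.const_mul _).sub (h2 v)).mul_const _).mul_const _
  have rhs : Tendsto (fun k => ∫ z, (l v' * (F k z * g z) + fderiv ℝ (F k) z v' * fderiv ℝ g z v)
      * w z ∂μ) atTop
      (𝓝 (∫ z, (l v' * (f z * g z) + fderiv ℝ f z v' * fderiv ℝ g z v) * w z ∂μ)) := by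
    refine tendsto_integral_of_dominated_convergence
      (fun z => ‖l v' * M * (g z * w z)‖ + ‖B * ‖v'‖ * w z * fderiv ℝ g z v‖)
      (fun k => ?_) ?_ (fun k => ?_) ?_
    · exact ((((measurable_const.mul ((hFmeas k).mul hgm))).add
        ((hdm _ _).mul (hdm _ _))).mul hwm).aestronglyMeasurable
    · refine (Integrable.norm ?_).add (Integrable.norm ?_)
      · exact Continuous.integrable_of_hasCompactSupport (by fun_prop) hgc.mul_right.mul_left
      · exact hg.integrable_continuous_mul_fderiv hgc (by fun_prop) v
    · refine ae_of_all _ fun z => ?_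
      rw [show (l v' * (F k z * g z) + fderiv ℝ (F k) z v' * fderiv ℝ g z v) * w z
        = l v' * F k z * (g z * w z) + fderiv ℝ (F k) z v' * w z * fderiv ℝ g z v by ring]
      refine (norm_add_le _ _).trans ?_
      simp only [norm_mul, Real.norm_eq_abs, abs_norm, NNReal.abs_eq]
      have h1 := (hFM k z).trans (le_abs_self M)
      have h2 := hFB k z v'
      gcongr
    · filter_upwards [lim, limd] with z h1 h2
      exact (((h1.mul_const _).const_mul _).add ((h2 v').mul_const _)).mul_const _
  refine tendsto_nhds_unique lhs ?_
  simp_rw [id_k]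
  exact rhs

omit [FiniteDimensional ℝ E] in
lemma LipschitzWith.integrable_stein_mul_stein {w f g : E → ℝ} {B C : ℝ≥0} (hw : Continuous w)
    (l l' : E →L[ℝ] ℝ) (v v' : E) (hf : LipschitzWith B f) (hfc : HasCompactSupport f)
    (hg : LipschitzWith C g) (hgc : HasCompactSupport g) :
    Integrable (fun z => (l z * f z - fderiv ℝ f z v) * (l' z * g z - fderiv ℝ g z v') * w z)
      μ := by
  have hfct := hf.continuous
  have hgct := hg.continuous
  have i1 : Integrable (fun z => l z * f z * (l' z * g z) * w z) μ :=
    Continuous.integrable_of_hasCompactSupport (by fun_prop) hfc.mul_left.mul_right.mul_right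
  have i2 : Integrable (fun z => l z * f z * w z * fderiv ℝ g z v') μ :=
    hg.integrable_continuous_mul_fderiv hgc (by fun_prop) v'
  have i3 : Integrable (fun z => l' z * g z * w z * fderiv ℝ f z v) μ :=
    hf.integrable_continuous_mul_fderiv hfc (by fun_prop) v
  have i4 : Integrable (fun z => w z * fderiv ℝ g z v' * fderiv ℝ f z v) μ :=
    (hg.integrable_continuous_mul_fderiv hgc hw v').mul_fderiv_of_lipschitz hf v
  refine (((i1.sub i2).sub i3).add i4).congr (ae_of_all _ fun z => ?_)
  simp only [Pi.add_apply, Pi.sub_apply]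
  ring

variable {ι : Type*} [DecidableEq ι] {w : E → ℝ} {e : ι → E} {l : ι → E →L[ℝ] ℝ}

omit [DecidableEq ι] in
lemma Finset.sum_sum_mul_swap_le (s : Finset ι) (d : ι → ι → ℝ) :
    ∑ a ∈ s, ∑ b ∈ s, d a b * d b a ≤ ∑ a ∈ s, ∑ b ∈ s, d a b ^ 2 := by
  have h : ∑ a ∈ s, ∑ b ∈ s, 2 * (d a b * d b a)
      ≤ ∑ a ∈ s, ∑ b ∈ s, (d a b ^ 2 + d b a ^ 2) :=
    Finset.sum_le_sum fun a _ => Finset.sum_le_sum fun b _ => by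
      nlinarith [sq_nonneg (d a b - d b a)]
  simp only [Finset.sum_add_distrib, ← Finset.mul_sum] at h
  rw [Finset.sum_comm (f := fun a b => d b a ^ 2)] at h
  linarith

lemma lintegral_stein_sq_le_of_lipschitz (hw : ContDiff ℝ 1 w) (hw0 : ∀ z, 0 ≤ w z)
    (hwe : ∀ a z, fderiv ℝ w z (e a) = -(l a z * w z))
    (hle : ∀ a b, l a (e b) = if a = b then 1 else 0) (s : Finset ι) {F : ι → E → ℝ}
    {C : ι → ℝ≥0} (hF : ∀ a, LipschitzWith (C a) (F a)) (hFc : ∀ a, HasCompactSupport (F a)) :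
    ∫⁻ z, ENNReal.ofReal ((∑ a ∈ s, (l a z * F a z - fderiv ℝ (F a) z (e a))) ^ 2 * w z) ∂μ
      ≤ ∫⁻ z, ENNReal.ofReal ((∑ a ∈ s, F a z ^ 2
        + ∑ a ∈ s, ∑ b ∈ s, fderiv ℝ (F a) z (e b) ^ 2) * w z) ∂μ := by
  have hwc := hw.continuous
  have hFct := fun a => (hF a).continuous
  let P : ι → E → ℝ := fun a z => l a z * F a z - fderiv ℝ (F a) z (e a)
  have iP : ∀ a b, Integrable (fun z => P a z * P b z * w z) μ := fun a b =>
    (hF a).integrable_stein_mul_stein hwc (l a) (l b) _ _ (hFc a) (hF b) (hFc b)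
  have iD : ∀ a b c d, Integrable
      (fun z => w z * fderiv ℝ (F a) z (e b) * fderiv ℝ (F c) z (e d)) μ := fun a b c d =>
    ((hF a).integrable_continuous_mul_fderiv (hFc a) hwc (e b)).mul_fderiv_of_lipschitz (hF c) (e d)
  have iF : ∀ a b, Integrable (fun z => F a z * F b z * w z) μ := fun a b =>
    Continuous.integrable_of_hasCompactSupport (by fun_prop) (hFc a).mul_right.mul_right
  have iQ : ∀ a b, Integrable (fun z => (l a (e b) * (F a z * F b z)
      + fderiv ℝ (F a) z (e b) * fderiv ℝ (F b) z (e a)) * w z) μ := fun a b => by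
    refine (((iF a b).const_mul (l a (e b))).add (iD a b b a)).congr (ae_of_all _ fun z => ?_)
    simp only [Pi.add_apply]
    ring
  have eL : ∀ z, (∑ a ∈ s, P a z) ^ 2 * w z = ∑ a ∈ s, ∑ b ∈ s, P a z * P b z * w z := fun z => by
    rw [sq, Finset.sum_mul_sum]
    simp only [Finset.sum_mul]
  have eR : ∀ z, (∑ a ∈ s, F a z ^ 2 + ∑ a ∈ s, ∑ b ∈ s, fderiv ℝ (F a) z (e b) ^ 2) * w z
      = ∑ a ∈ s, F a z * F a z * w z + ∑ a ∈ s, ∑ b ∈ s,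
        w z * fderiv ℝ (F a) z (e b) * fderiv ℝ (F a) z (e b) := fun z => by
    simp only [add_mul, Finset.sum_mul]
    congr 1
    · exact Finset.sum_congr rfl fun a _ => by ring
    · exact Finset.sum_congr rfl fun a _ => Finset.sum_congr rfl fun b _ => by ring
  have iL : Integrable (fun z => (∑ a ∈ s, P a z) ^ 2 * w z) μ := by
    simp_rw [eL]
    exact integrable_finsetSum _ fun a _ => integrable_finsetSum _ fun b _ => iP a b
  have iR : Integrable (fun z => (∑ a ∈ s, F a z ^ 2
      + ∑ a ∈ s, ∑ b ∈ s, fderiv ℝ (F a) z (e b) ^ 2) * w z) μ := by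
    simp_rw [eR]
    exact (integrable_finsetSum _ fun a _ => iF a a).add
      (integrable_finsetSum _ fun a _ => integrable_finsetSum _ fun b _ => iD a b a b)
  rw [← ofReal_integral_eq_lintegral_ofReal iL (ae_of_all _ fun z => mul_nonneg (sq_nonneg _) (hw0 z)),
    ← ofReal_integral_eq_lintegral_ofReal iR (ae_of_all _ fun z => mul_nonneg (by positivity) (hw0 z))]
  refine ENNReal.ofReal_le_ofReal ?_
  calc ∫ z, (∑ a ∈ s, P a z) ^ 2 * w z ∂μ
      = ∑ a ∈ s, ∑ b ∈ s, ∫ z, P a z * P b z * w z ∂μ := by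
        simp_rw [eL]
        rw [integral_finsetSum _ fun a _ => integrable_finsetSum _ fun b _ => iP a b]
        exact Finset.sum_congr rfl fun a _ => integral_finsetSum _ fun b _ => iP a b
    _ = ∑ a ∈ s, ∑ b ∈ s, ∫ z, (l a (e b) * (F a z * F b z)
          + fderiv ℝ (F a) z (e b) * fderiv ℝ (F b) z (e a)) * w z ∂μ :=
        Finset.sum_congr rfl fun a _ => Finset.sum_congr rfl fun b _ =>
          integral_stein_mul_stein hw (hwe a) (hwe b) (hF a) (hFc a) (hF b) (hFc b)
    _ = ∫ z, ∑ a ∈ s, ∑ b ∈ s, (l a (e b) * (F a z * F b z)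
          + fderiv ℝ (F a) z (e b) * fderiv ℝ (F b) z (e a)) * w z ∂μ := by
        rw [integral_finsetSum _ fun a _ => integrable_finsetSum _ fun b _ => iQ a b]
        exact Finset.sum_congr rfl fun a _ => (integral_finsetSum _ fun b _ => iQ a b).symm
    _ ≤ _ := by
        refine integral_mono
          (integrable_finsetSum _ fun a _ => integrable_finsetSum _ fun b _ => iQ a b) iR fun z => ?_
        simp only [← Finset.sum_mul, Finset.sum_add_distrib]
        refine mul_le_mul_of_nonneg_right (add_le_add (le_of_eq ?_) ?_) (hw0 z)
        · refine Finset.sum_congr rfl fun a ha => ?_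
          simp [hle, ha, sq]
        · exact s.sum_sum_mul_swap_le fun a b => fderiv ℝ (F a) z (e b)

omit [NormedSpace ℝ E] [FiniteDimensional ℝ E] [MeasurableSpace E] [BorelSpace E] in
lemma LocallyLipschitz.exists_lipschitzWith_of_hasCompactSupport [ProperSpace E] {f : E → ℝ}
    (hf : LocallyLipschitz f) (hfc : HasCompactSupport f) : ∃ C, LipschitzWith C f := by
  obtain ⟨R, hR⟩ := hfc.isCompact.isBounded.subset_closedBall (0 : E)
  obtain ⟨C, hC⟩ := (hf.locallyLipschitzOn (s := Metric.closedBall 0 (R + 1))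
    ).exists_lipschitzOnWith_of_compact (isCompact_closedBall _ _)
  obtain ⟨M, hM⟩ := hfc.exists_bound_of_continuous hf.continuous
  have hz : ∀ x : E, R < ‖x‖ → f x = 0 := fun x hx => by
    refine image_eq_zero_of_notMem_tsupport fun h => ?_
    have := hR h
    rw [mem_closedBall_zero_iff] at this
    linarith
  have far : ∀ x y : E, R + 1 < ‖y‖ → |f x - f y| ≤ M * dist x y := fun x y hy => by
    rw [hz y (by linarith), sub_zero]
    have hM0 : 0 ≤ M := (norm_nonneg _).trans (hM x)
    by_cases hx : R < ‖x‖
    · rw [hz x hx, abs_zero]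
      positivity
    · have : 1 ≤ dist x y := by
        have := norm_sub_norm_le y x
        rw [dist_eq_norm, norm_sub_rev]
        linarith
      exact (hM x).trans (le_mul_of_one_le_right hM0 this)
  refine ⟨max C M.toNNReal, LipschitzWith.of_dist_le_mul fun x y => ?_⟩
  rw [Real.dist_eq, NNReal.coe_max]
  by_cases hx : R + 1 < ‖x‖
  · rw [abs_sub_comm, dist_comm]
    refine (far y x hx).trans ?_
    gcongr
    exact (Real.le_coe_toNNReal M).trans (le_max_right _ _)
  by_cases hy : R + 1 < ‖y‖
  · refine (far x y hy).trans ?_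
    gcongr
    exact (Real.le_coe_toNNReal M).trans (le_max_right _ _)
  · have := hC.dist_le_mul x (by simpa using hx) y (by simpa using hy)
    rw [Real.dist_eq] at this
    refine this.trans ?_
    gcongr
    exact le_max_left _ _

lemma LocallyLipschitz.ae_differentiableAt {G : Type*} [NormedAddCommGroup G] [NormedSpace ℝ G]
    [FiniteDimensional ℝ G] {f : E → G} (hf : LocallyLipschitz f) :
    ∀ᵐ z ∂μ, DifferentiableAt ℝ f z := by
  have : ProperSpace E := FiniteDimensional.proper_real E
  have h : ∀ k : ℕ, ∀ᵐ z ∂μ, z ∈ Metric.closedBall (0 : E) k →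
      DifferentiableWithinAt ℝ f (Metric.closedBall 0 k) z := fun k => by
    obtain ⟨C, hC⟩ := (hf.locallyLipschitzOn (s := Metric.closedBall 0 k)
      ).exists_lipschitzOnWith_of_compact (isCompact_closedBall _ _)
    exact hC.ae_differentiableWithinAt_of_mem
  filter_upwards [ae_all_iff.2 h] with z hz
  obtain ⟨k, hk⟩ := exists_nat_gt ‖z‖
  refine (hz k (by simpa using hk.le)).differentiableAt ?_
  exact mem_of_superset (Metric.isOpen_ball.mem_nhds (by simpa using hk)) Metric.ball_subset_closedBall

omit [NormedSpace ℝ E] [FiniteDimensional ℝ E] [NormedAddCommGroup E] [BorelSpace E]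
  [μ.IsAddHaarMeasure] in
lemma lintegral_le_of_ae_tendsto {f : ℕ → E → ℝ≥0∞} {g : E → ℝ≥0∞} {B : ℝ≥0∞}
    (hf : ∀ k, Measurable (f k)) (hfg : ∀ᵐ z ∂μ, Tendsto (fun k => f k z) atTop (𝓝 (g z)))
    (hB : ∀ᶠ k in atTop, ∫⁻ z, f k z ∂μ ≤ B) : ∫⁻ z, g z ∂μ ≤ B := by
  calc ∫⁻ z, g z ∂μ = ∫⁻ z, liminf (fun k => f k z) atTop ∂μ :=
        lintegral_congr_ae (hfg.mono fun z hz => hz.liminf_eq.symm)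
    _ ≤ liminf (fun k => ∫⁻ z, f k z ∂μ) atTop := lintegral_liminf_le hf
    _ ≤ B := liminf_le_of_frequently_le' hB.frequently

omit [NormedSpace ℝ E] [FiniteDimensional ℝ E] [MeasurableSpace E] [BorelSpace E] in
lemma LocallyLipschitz.mul_real {f g : E → ℝ} (hf : LocallyLipschitz f)
    (hg : LocallyLipschitz g) : LocallyLipschitz fun z => f z * g z := by
  have h : ContDiff ℝ 1 fun p : ℝ × ℝ => p.1 * p.2 := contDiff_fst.mul contDiff_snd
  exact h.locallyLipschitz.comp (hf.prodMk hg)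

/-- Continuous cutoff equal to `1` on the ball of radius `k + 1` and to `0` outside the ball of
radius `2 * (k + 1)`. -/
def radialCutoff (E : Type*) [Norm E] (k : ℕ) (z : E) : ℝ :=
  max 0 (min 1 (2 - ‖z‖ / (k + 1)))

omit [NormedSpace ℝ E] [FiniteDimensional ℝ E] [MeasurableSpace E] [BorelSpace E] in
lemma lipschitzWith_radialCutoff (k : ℕ) :
    LipschitzWith (1 / (k + 1) : ℝ≥0) (radialCutoff E k) := by
  have h : LipschitzWith (1 / (k + 1) : ℝ≥0) fun z : E => 2 - ‖z‖ / (k + 1) := by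
    refine LipschitzWith.of_dist_le_mul fun x y => ?_
    rw [Real.dist_eq, sub_sub_sub_cancel_left, ← sub_div, abs_div, abs_sub_comm, dist_eq_norm]
    have hk : |(k : ℝ) + 1| = k + 1 := abs_of_pos (by positivity)
    rw [hk, div_eq_inv_mul]
    push_cast
    rw [one_div]
    gcongr
    exact abs_norm_sub_norm_le x y
  exact (h.const_min 1).const_max 0

omit [NormedSpace ℝ E] [FiniteDimensional ℝ E] [MeasurableSpace E] [BorelSpace E] in
lemma hasCompactSupport_radialCutoff [ProperSpace E] (k : ℕ) :
    HasCompactSupport (radialCutoff E k) := by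
  refine HasCompactSupport.intro (isCompact_closedBall (0 : E) (2 * (k + 1))) fun z hz => ?_
  have hz' : 2 * ((k : ℝ) + 1) < ‖z‖ := by simpa using hz
  have : 2 - ‖z‖ / (k + 1) ≤ 0 := by
    rw [sub_nonpos, le_div_iff₀ (by positivity)]
    exact hz'.le
  exact max_eq_left ((min_le_right _ _).trans this)

omit [NormedSpace ℝ E] [FiniteDimensional ℝ E] [MeasurableSpace E] [BorelSpace E] in
lemma radialCutoff_nonneg (k : ℕ) (z : E) : 0 ≤ radialCutoff E k z := le_max_left _ _

omit [NormedSpace ℝ E] [FiniteDimensional ℝ E] [MeasurableSpace E] [BorelSpace E] in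
lemma radialCutoff_le_one (k : ℕ) (z : E) : radialCutoff E k z ≤ 1 :=
  max_le zero_le_one (min_le_left _ _)

omit [NormedSpace ℝ E] [FiniteDimensional ℝ E] [MeasurableSpace E] [BorelSpace E] in
lemma radialCutoff_eventuallyEq {k : ℕ} {z : E} (hz : ‖z‖ < k) :
    radialCutoff E k =ᶠ[𝓝 z] fun _ => 1 := by
  filter_upwards [continuous_norm.continuousAt.eventually_lt_const hz] with y hy
  have : 1 ≤ 2 - ‖y‖ / (k + 1) := by
    have : ‖y‖ / (k + 1) ≤ 1 := by
      rw [div_le_one (by positivity)]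
      linarith
    linarith
  simp [radialCutoff, min_eq_left this]

omit [FiniteDimensional ℝ E] [MeasurableSpace E] [BorelSpace E] [DecidableEq ι] in
lemma eventually_sum_sq_fderiv_radialCutoff_le (s : Finset ι) (e : ι → E) :
    ∀ᶠ k : ℕ in atTop, ∀ z, ∑ b ∈ s, fderiv ℝ (radialCutoff E k) z (e b) ^ 2 ≤ 1 := by
  have h : Tendsto (fun k : ℕ => ∑ b ∈ s, (1 / ((k : ℝ) + 1) * ‖e b‖) ^ 2) atTop (𝓝 0) := by
    have := tendsto_finsetSum (f := fun b (k : ℕ) => (1 / ((k : ℝ) + 1) * ‖e b‖) ^ 2) s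
      fun b _ => ((tendsto_one_div_add_atTop_nhds_zero_nat (𝕜 := ℝ)).mul_const ‖e b‖).pow 2
    simpa using this
  filter_upwards [h.eventually_le_const zero_lt_one] with k hk z
  refine (Finset.sum_le_sum fun b _ => ?_).trans hk
  have := (lipschitzWith_radialCutoff (E := E) k).abs_fderiv_apply_le z (e b)
  push_cast at this
  rw [← sq_abs]
  gcongr

/-- Second-order Stein inequality for locally Lipschitz vector fields. -/
lemma lintegral_stein_sq_le (hw : ContDiff ℝ 1 w) (hw0 : ∀ z, 0 ≤ w z)
    (hwe : ∀ a z, fderiv ℝ w z (e a) = -(l a z * w z))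
    (hle : ∀ a b, l a (e b) = if a = b then 1 else 0) (s : Finset ι) {F : ι → E → ℝ}
    (hF : ∀ a, LocallyLipschitz (F a)) :
    ∫⁻ z, ENNReal.ofReal ((∑ a ∈ s, (l a z * F a z - fderiv ℝ (F a) z (e a))) ^ 2 * w z) ∂μ
      ≤ ∫⁻ z, ENNReal.ofReal ((3 * ∑ a ∈ s, F a z ^ 2
        + 2 * ∑ a ∈ s, ∑ b ∈ s, fderiv ℝ (F a) z (e b) ^ 2) * w z) ∂μ := by
  have : ProperSpace E := FiniteDimensional.proper_real E
  let G : ℕ → ι → E → ℝ := fun k a z => radialCutoff E k z * F a z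
  have hGl : ∀ k a, LocallyLipschitz (G k a) := fun k a =>
    (lipschitzWith_radialCutoff k).locallyLipschitz.mul_real (hF a)
  have hGc : ∀ k a, HasCompactSupport (G k a) := fun k a =>
    (hasCompactSupport_radialCutoff k).mul_right
  have hG := fun k a => (hGl k a).exists_lipschitzWith_of_hasCompactSupport (hGc k a)
  choose C hC using hG
  refine lintegral_le_of_ae_tendsto
    (f := fun k z => ENNReal.ofReal
      ((∑ a ∈ s, (l a z * G k a z - fderiv ℝ (G k a) z (e a))) ^ 2 * w z)) (fun k => ?_) ?_ ?_
  · have h1 : ∀ a, Measurable fun z => l a z * G k a z - fderiv ℝ (G k a) z (e a) := fun a =>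
      ((l a).continuous.measurable.mul (hGl k a).continuous.measurable).sub
        (measurable_fderiv_apply_const ℝ _ _)
    exact (((Finset.measurable_sum s fun a _ => h1 a).pow_const 2).mul
      hw.continuous.measurable).ennreal_ofReal
  · refine ae_of_all _ fun z => tendsto_const_nhds.congr' ?_
    obtain ⟨N, hN⟩ := exists_nat_gt ‖z‖
    filter_upwards [eventually_ge_atTop N] with k hk
    have hzk : ‖z‖ < k := hN.trans_le (by exact_mod_cast hk)
    have hGF : ∀ a, G k a =ᶠ[𝓝 z] F a := fun a => by
      filter_upwards [radialCutoff_eventuallyEq hzk] with y hy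
      simp [G, hy]
    simp only [fun a => (hGF a).eq_of_nhds, fun a => (hGF a).fderiv_eq (𝕜 := ℝ)]
  · filter_upwards [eventually_sum_sq_fderiv_radialCutoff_le s e] with k hk
    refine (lintegral_stein_sq_le_of_lipschitz hw hw0 hwe hle s (hC k) (hGc k)).trans ?_
    refine lintegral_mono_ae ?_
    have hFd : ∀ᵐ z ∂μ, ∀ a ∈ s, DifferentiableAt ℝ (F a) z :=
      (Filter.eventually_all_finset s).2 fun a _ => (hF a).ae_differentiableAt
    filter_upwards [hFd, (lipschitzWith_radialCutoff (E := E) k).ae_differentiableAt] with z hz hχ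
    refine ENNReal.ofReal_le_ofReal (mul_le_mul_of_nonneg_right ?_ (hw0 z))
    have h0 := radialCutoff_nonneg k z
    have h1 := radialCutoff_le_one k z
    have hχ1 : radialCutoff E k z ^ 2 ≤ 1 := pow_le_one₀ h0 h1
    have hsq : ∑ a ∈ s, G k a z ^ 2 ≤ ∑ a ∈ s, F a z ^ 2 := Finset.sum_le_sum fun a _ => by
      rw [mul_pow]
      exact mul_le_of_le_one_left (sq_nonneg _) hχ1
    have hd : ∀ a ∈ s, ∀ b, fderiv ℝ (G k a) z (e b) ^ 2 ≤ 2 * fderiv ℝ (F a) z (e b) ^ 2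
        + 2 * (F a z ^ 2 * fderiv ℝ (radialCutoff E k) z (e b) ^ 2) := fun a ha b => by
      have h3 : HasFDerivAt (G k a) _ z := hχ.hasFDerivAt.mul (hz a ha).hasFDerivAt
      rw [h3.fderiv]
      simp only [_root_.add_apply, _root_.smul_apply, smul_eq_mul]
      set x := radialCutoff E k z
      set d := fderiv ℝ (F a) z (e b)
      set y := F a z * fderiv ℝ (radialCutoff E k) z (e b)
      have h4 : (x * d) ^ 2 ≤ d ^ 2 := by
        rw [mul_pow]
        exact mul_le_of_le_one_left (sq_nonneg _) hχ1
      rw [← mul_pow]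
      nlinarith [sq_nonneg (x * d - y)]
    have hdd : ∑ a ∈ s, ∑ b ∈ s, fderiv ℝ (G k a) z (e b) ^ 2
        ≤ 2 * ∑ a ∈ s, ∑ b ∈ s, fderiv ℝ (F a) z (e b) ^ 2 + 2 * ∑ a ∈ s, F a z ^ 2 := by
      rw [Finset.mul_sum, Finset.mul_sum, ← Finset.sum_add_distrib]
      refine Finset.sum_le_sum fun a ha => ?_
      refine (Finset.sum_le_sum fun b _ => hd a ha b).trans ?_
      rw [Finset.sum_add_distrib, ← Finset.mul_sum, ← Finset.mul_sum, ← Finset.mul_sum]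
      gcongr
      exact mul_le_of_le_one_right (sq_nonneg _) (hk z)
    linarith

end GaussianTypeWeight

lemma MeasureTheory.Measure.pi_withDensity_ofReal {ι : Type*} [Fintype ι] {X : ι → Type*}
    [∀ i, MeasurableSpace (X i)] (μ : ∀ i, Measure (X i)) [∀ i, SigmaFinite (μ i)]
    {f : ∀ i, X i → ℝ} (hf0 : ∀ i x, 0 ≤ f i x) (hf : ∀ i, Integrable (f i) (μ i)) :
    Measure.pi (fun i => (μ i).withDensity fun x => ENNReal.ofReal (f i x))
      = (Measure.pi μ).withDensity fun x => ENNReal.ofReal (∏ i, f i (x i)) := by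
  have := fun i => isFiniteMeasure_withDensity_ofReal (hf i).2
  refine Measure.pi_eq fun s hs => ?_
  rw [withDensity_apply _ (MeasurableSet.univ_pi hs), Measure.restrict_pi_pi,
    ← ofReal_integral_eq_lintegral_ofReal
      (Integrable.fintype_prod_dep fun i => (hf i).restrict)
      (ae_of_all _ fun x => Finset.prod_nonneg fun i _ => hf0 i (x i)),
    integral_fintype_prod_eq_prod,
    ENNReal.ofReal_prod_of_nonneg fun i _ => integral_nonneg (hf0 i)]
  refine Finset.prod_congr rfl fun i _ => ?_
  rw [withDensity_apply _ (hs i), ofReal_integral_eq_lintegral_ofReal (hf i).restrict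
    (ae_of_all _ (hf0 i))]

/-- Lebesgue density of `stdGaussMat`. -/
def stdGaussMatPDF (n q : ℕ) (z : Fin n → Fin q → ℝ) : ℝ :=
  (∏ _i : Fin n, ∏ _j : Fin q, (√(2 * Real.pi))⁻¹) * Real.exp (-(∑ i, ∑ j, z i j ^ 2) / 2)

lemma stdGaussMatPDF_nonneg (n q : ℕ) (z : Fin n → Fin q → ℝ) : 0 ≤ stdGaussMatPDF n q z := by
  unfold stdGaussMatPDF
  positivity

lemma contDiff_stdGaussMatPDF (n q : ℕ) : ContDiff ℝ 1 (stdGaussMatPDF n q) := by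
  unfold stdGaussMatPDF
  fun_prop

lemma stdGaussMat_eq_withDensity (n q : ℕ) :
    stdGaussMat n q = volume.withDensity fun z => ENNReal.ofReal (stdGaussMatPDF n q z) := by
  have hg : gaussianReal 0 1 = volume.withDensity fun x => ENNReal.ofReal (gaussianPDFReal 0 1 x) :=
    gaussianReal_of_var_ne_zero 0 one_ne_zero
  have hi : Integrable (gaussianPDFReal 0 1) := integrable_gaussianPDFReal 0 1
  have h0 : ∀ x, 0 ≤ gaussianPDFReal 0 1 x := gaussianPDFReal_nonneg 0 1
  have hrow : Measure.pi (fun _ : Fin q => gaussianReal 0 1)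
      = volume.withDensity fun x => ENNReal.ofReal (∏ j, gaussianPDFReal 0 1 (x j)) := by
    rw [hg, Measure.pi_withDensity_ofReal _ (fun _ => h0) fun _ => hi]
    rfl
  have hmat := Measure.pi_withDensity_ofReal (ι := Fin n) (fun _ => (volume : Measure (Fin q → ℝ)))
    (f := fun _ x => ∏ j, gaussianPDFReal 0 1 (x j))
    (fun _ x => Finset.prod_nonneg fun j _ => h0 (x j)) fun _ => Integrable.fintype_prod fun _ => hi
  rw [stdGaussMat, hrow, hmat]
  refine congrArg (Measure.withDensity volume) (funext fun z => congrArg ENNReal.ofReal ?_)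
  simp only [gaussianPDFReal, stdGaussMatPDF, Finset.prod_mul_distrib, ← Real.exp_sum]
  congr 2
  · simp
  · simp [← Finset.sum_div, Finset.sum_neg_distrib]

/-- The entry `z i j` as a continuous linear functional. -/
def entryCLM {n q : ℕ} (p : Fin n × Fin q) : (Fin n → Fin q → ℝ) →L[ℝ] ℝ :=
  (ContinuousLinearMap.proj (R := ℝ) (φ := fun _ : Fin q => ℝ) p.2).comp
    (ContinuousLinearMap.proj (R := ℝ) (φ := fun _ : Fin n => Fin q → ℝ) p.1)

@[simp]
lemma entryCLM_apply {n q : ℕ} (p : Fin n × Fin q) (z : Fin n → Fin q → ℝ) :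
    entryCLM p z = z p.1 p.2 := rfl

lemma single_single_apply {n q : ℕ} (i i' : Fin n) (j j' : Fin q) :
    (Pi.single i (Pi.single j 1) : Fin n → Fin q → ℝ) i' j' = if (i', j') = (i, j) then 1 else 0 := by
  by_cases hi : i' = i
  · subst hi
    simp [Pi.single_apply]
  · simp [hi]

lemma fderiv_stdGaussMatPDF (n q : ℕ) (p : Fin n × Fin q) (z : Fin n → Fin q → ℝ) :
    fderiv ℝ (stdGaussMatPDF n q) z (Pi.single p.1 (Pi.single p.2 1))
      = -(entryCLM p z * stdGaussMatPDF n q z) := by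
  have h : HasFDerivAt (fun z : Fin n → Fin q → ℝ => ∑ i, ∑ j, z i j ^ 2)
      (∑ i, ∑ j, (2 * z i j) • entryCLM (i, j)) z := by
    refine HasFDerivAt.fun_sum fun i _ => HasFDerivAt.fun_sum fun j _ => ?_
    simpa using (entryCLM (i, j)).hasFDerivAt.pow (x := z) 2
  have h2 : HasFDerivAt (stdGaussMatPDF n q) _ z :=
    ((h.neg.mul_const (2⁻¹ : ℝ)).exp).const_mul
      (∏ _i : Fin n, ∏ _j : Fin q, (√(2 * Real.pi))⁻¹)
  rw [h2.fderiv]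
  simp only [_root_.smul_apply, _root_.neg_apply, _root_.sum_apply, entryCLM_apply,
    single_single_apply, smul_eq_mul, stdGaussMatPDF, div_eq_mul_inv]
  rw [← Finset.sum_product' (f := fun i j => 2 * z i j * if (i, j) = (p.1, p.2) then 1 else 0)]
  simp
  ring

instance (n q : ℕ) : IsProbabilityMeasure (stdGaussMat n q) := by
  unfold stdGaussMat
  infer_instance

lemma stdGaussMat_absolutelyContinuous (n q : ℕ) : stdGaussMat n q ≪ volume := by
  rw [stdGaussMat_eq_withDensity]
  exact withDensity_absolutelyContinuous _ _

/-- Second-order Stein inequality for the standard Gaussian matrix. -/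
lemma lintegral_stein_sq_stdGaussMat_le {n q : ℕ} (s : Finset (Fin n × Fin q))
    {F : Fin n × Fin q → (Fin n → Fin q → ℝ) → ℝ} (hF : ∀ p, LocallyLipschitz (F p)) :
    ∫⁻ z, ENNReal.ofReal ((∑ p ∈ s, (z p.1 p.2 * F p z
        - fderiv ℝ (F p) z (Pi.single p.1 (Pi.single p.2 1)))) ^ 2) ∂stdGaussMat n q
      ≤ ∫⁻ z, ENNReal.ofReal (3 * ∑ p ∈ s, F p z ^ 2
        + 2 * ∑ p ∈ s, ∑ p' ∈ s, fderiv ℝ (F p) z (Pi.single p'.1 (Pi.single p'.2 1)) ^ 2)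
          ∂stdGaussMat n q := by
  have key := lintegral_stein_sq_le (μ := volume) (contDiff_stdGaussMatPDF n q)
    (stdGaussMatPDF_nonneg n q) (fderiv_stdGaussMatPDF n q)
    (fun a b => by rw [entryCLM_apply, single_single_apply]) s hF
  have hm : Measurable fun z => ENNReal.ofReal (stdGaussMatPDF n q z) :=
    (contDiff_stdGaussMatPDF n q).continuous.measurable.ennreal_ofReal
  rw [stdGaussMat_eq_withDensity,
    lintegral_withDensity_eq_lintegral_mul_non_measurable _ hm (ae_of_all _ fun _ => ENNReal.ofReal_lt_top),
    lintegral_withDensity_eq_lintegral_mul_non_measurable _ hm (ae_of_all _ fun _ => ENNReal.ofReal_lt_top)]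
  simp only [Pi.mul_apply, ← ENNReal.ofReal_mul (stdGaussMatPDF_nonneg n q _)]
  simpa only [mul_comm (stdGaussMatPDF n q _), entryCLM_apply] using key

lemma sum_sq_row_le_matOpNorm {n q : ℕ} (J : Finset (Fin n)) (z : Fin n → Fin q → ℝ)
    (x : Fin q → ℝ) :
    ∑ i ∈ J, (∑ m, z i m * x m) ^ 2
      ≤ matOpNorm (Matrix.of fun i j => if i ∈ J then z i j else 0) ^ 2 * ∑ m, x m ^ 2 := by
  set A : Matrix (Fin n) (Fin q) ℝ := Matrix.of fun i j => if i ∈ J then z i j else 0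
  have h := (LinearMap.toContinuousLinearMap (Matrix.toEuclideanLin A)).le_opNorm (WithLp.toLp 2 x)
  have h2 := pow_le_pow_left₀ (norm_nonneg _) h 2
  rw [mul_pow, EuclideanSpace.norm_sq_eq, EuclideanSpace.norm_sq_eq] at h2
  have hA : ∀ i, (Matrix.toEuclideanLin A (WithLp.toLp 2 x)) i
      = if i ∈ J then ∑ m, z i m * x m else 0 := fun i => by
    simp only [Matrix.toLpLin_apply, Matrix.mulVec, dotProduct, A, Matrix.of_apply]
    split_ifs <;> simp
  simp only [LinearMap.coe_toContinuousLinearMap', hA, Real.norm_eq_abs, sq_abs] at h2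
  simpa [matOpNorm, Finset.sum_ite_mem, ite_pow] using h2

lemma sum_sq_jacobian_le {n q : ℕ} (J : Finset (Fin n)) (z : Fin n → Fin q → ℝ) {K : ℝ}
    (hK : ∀ x : Fin q → ℝ, ∑ i ∈ J, (∑ m, z i m * x m) ^ 2 ≤ K * ∑ m, x m ^ 2) (hK0 : 0 ≤ K)
    {u v : Fin q → ℝ} (hu : ∑ m, u m ^ 2 ≤ 1) (hv : ∑ m, v m ^ 2 ≤ 1)
    (U V : Fin n × Fin q → Fin q → ℝ) :
    ∑ p ∈ J ×ˢ Finset.univ, ∑ p' ∈ J ×ˢ Finset.univ,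
      (((if p.1 = p'.1 then u p'.2 else 0) + ∑ m, z p.1 m * U p' m) * v p.2
        + (∑ m, z p.1 m * u m) * V p' p.2) ^ 2
      ≤ 3 * (J.card + K * ∑ p ∈ J ×ˢ Finset.univ, ∑ m, U p m ^ 2
        + K * ∑ p ∈ J ×ˢ Finset.univ, ∑ m, V p m ^ 2) := by
  rw [Finset.sum_comm]
  have hp : ∀ p' : Fin n × Fin q, ∑ p ∈ J ×ˢ Finset.univ,
      (((if p.1 = p'.1 then u p'.2 else 0) + ∑ m, z p.1 m * U p' m) * v p.2
        + (∑ m, z p.1 m * u m) * V p' p.2) ^ 2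
      ≤ 3 * (u p'.2 ^ 2 + K * ∑ m, U p' m ^ 2 + K * ∑ m, V p' m ^ 2) := fun p' => by
    obtain ⟨a, ha⟩ : ∃ a : Fin n → ℝ, ∀ i, (if i = p'.1 then u p'.2 else 0) = a i :=
      ⟨_, fun _ => rfl⟩
    simp only [ha]
    have h1 : ∑ i ∈ J, a i ^ 2 ≤ u p'.2 ^ 2 := by
      simp only [← ha, ite_pow]
      rw [zero_pow two_ne_zero, Finset.sum_ite_eq']
      split_ifs
      · exact le_rfl
      · positivity
    have h2 := hK (U p')
    have h3 : ∑ i ∈ J, (∑ m, z i m * u m) ^ 2 ≤ K :=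
      (hK u).trans (mul_le_of_le_one_right hK0 hu)
    calc _ ≤ ∑ p ∈ J ×ˢ (Finset.univ : Finset (Fin q)),
          3 * (a p.1 ^ 2 * v p.2 ^ 2
          + (∑ m, z p.1 m * U p' m) ^ 2 * v p.2 ^ 2
          + (∑ m, z p.1 m * u m) ^ 2 * V p' p.2 ^ 2) := by
          refine Finset.sum_le_sum fun p _ => ?_
          generalize a p.1 = a
          generalize ∑ m, z p.1 m * U p' m = b
          generalize ∑ m, z p.1 m * u m = c
          nlinarith [sq_nonneg (a * v p.2 - b * v p.2), sq_nonneg (a * v p.2 - c * V p' p.2),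
            sq_nonneg (b * v p.2 - c * V p' p.2)]
      _ = 3 * ((∑ i ∈ J, a i ^ 2) * ∑ m, v m ^ 2
          + (∑ i ∈ J, (∑ m, z i m * U p' m) ^ 2) * ∑ m, v m ^ 2
          + (∑ i ∈ J, (∑ m, z i m * u m) ^ 2) * ∑ m, V p' m ^ 2) := by
          simp only [Finset.sum_mul_sum]
          simp only [← Finset.mul_sum, Finset.sum_add_distrib, Finset.sum_product]
      _ ≤ _ := by
          have h4 : (∑ i ∈ J, (∑ m, z i m * U p' m) ^ 2) * ∑ m, v m ^ 2
              ≤ K * ∑ m, U p' m ^ 2 := (mul_le_of_le_one_right (by positivity) hv).trans h2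
          have h5 := (mul_le_of_le_one_right (Finset.sum_nonneg fun i _ => sq_nonneg _) hv).trans h1
          have h6 := mul_le_mul_of_nonneg_right h3
            (show 0 ≤ ∑ m, V p' m ^ 2 from Finset.sum_nonneg fun m _ => sq_nonneg _)
          linarith
  refine (Finset.sum_le_sum fun p' _ => hp p').trans ?_
  rw [← Finset.mul_sum, Finset.sum_add_distrib, Finset.sum_add_distrib, ← Finset.mul_sum,
    ← Finset.mul_sum]
  gcongr
  rw [Finset.sum_product]
  simpa using mul_le_of_le_one_right (Nat.cast_nonneg (α := ℝ) J.card) hu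

/-- Regularised inverse Euclidean norm `(‖x‖² + ε)^(-1/2)`. -/
def regInvNorm {q : ℕ} (ε : ℝ) (x : Fin q → ℝ) : ℝ := (√(∑ m, x m ^ 2 + ε))⁻¹

section RegInvNorm

variable {q : ℕ} {ε : ℝ}

lemma sum_sq_add_pos (hε : 0 < ε) (x : Fin q → ℝ) : 0 < ∑ m, x m ^ 2 + ε := by positivity

lemma regInvNorm_sq (hε : 0 < ε) (x : Fin q → ℝ) :
    regInvNorm ε x ^ 2 = (∑ m, x m ^ 2 + ε)⁻¹ := by
  rw [regInvNorm, inv_pow, Real.sq_sqrt (sum_sq_add_pos hε x).le]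

lemma contDiff_regInvNorm (hε : 0 < ε) : ContDiff ℝ 1 (regInvNorm (q := q) ε) := by
  unfold regInvNorm
  refine ContDiff.inv (ContDiff.sqrt (by fun_prop) fun x => (sum_sq_add_pos hε x).ne') fun x => ?_
  exact (Real.sqrt_pos.2 (sum_sq_add_pos hε x)).ne'

lemma regInvNorm_sq_mul_sum_sq_le_one (hε : 0 < ε) (x : Fin q → ℝ) :
    regInvNorm ε x ^ 2 * ∑ m, x m ^ 2 ≤ 1 := by
  rw [regInvNorm_sq hε, inv_mul_le_one₀ (sum_sq_add_pos hε x)]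
  linarith

lemma regInvNorm_sq_le (hε : 0 < ε) {x : Fin q → ℝ} (hx : 0 < ∑ m, x m ^ 2) :
    regInvNorm ε x ^ 2 ≤ (∑ m, x m ^ 2)⁻¹ := by
  rw [regInvNorm_sq hε]
  exact inv_anti₀ hx (by linarith)

lemma hasFDerivAt_regInvNorm_comp {E : Type*} [NormedAddCommGroup E] [NormedSpace ℝ E] (hε : 0 < ε)
    {h : E → Fin q → ℝ} {h' : E →L[ℝ] Fin q → ℝ} {z : E} (hh : HasFDerivAt h h' z) :
    HasFDerivAt (fun z => regInvNorm ε (h z)) (-(regInvNorm ε (h z) ^ 3) •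
      ∑ m, h z m • (ContinuousLinearMap.proj (R := ℝ) (φ := fun _ : Fin q => ℝ) m).comp h') z := by
  have hm : ∀ m, HasFDerivAt (fun z => h z m)
      ((ContinuousLinearMap.proj (R := ℝ) (φ := fun _ : Fin q => ℝ) m).comp h') z :=
    hasFDerivAt_pi'.1 hh
  have hS : HasFDerivAt (fun z => ∑ m, h z m ^ 2 + ε)
      (∑ m, (2 * h z m) •
        (ContinuousLinearMap.proj (R := ℝ) (φ := fun _ : Fin q => ℝ) m).comp h') z := by
    refine (HasFDerivAt.fun_sum fun m _ => ?_).add_const ε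
    simpa using (hm m).pow 2
  have hpos := sum_sq_add_pos hε (h z)
  have hsq := Real.sqrt_pos.2 hpos
  have h1 := (((Real.hasDerivAt_sqrt hpos.ne').inv hsq.ne').comp_hasFDerivAt z hS)
  refine h1.congr_fderiv ?_
  refine ContinuousLinearMap.ext fun y => ?_
  simp only [_root_.smul_apply, _root_.sum_apply, smul_eq_mul, mul_assoc, ← Finset.mul_sum]
  rw [regInvNorm]
  field_simp

/-- The derivative of `x ↦ x / √(‖x‖² + ε)` is a contraction of `dx / ‖x‖`. -/
lemma sum_sq_regInvNorm_deriv_le (hε : 0 < ε) {x : Fin q → ℝ} (hx : 0 < ∑ m, x m ^ 2)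
    (d : Fin q → ℝ) :
    ∑ m, (regInvNorm ε x * d m - regInvNorm ε x ^ 3 * (∑ k, x k * d k) * x m) ^ 2
      ≤ (∑ m, d m ^ 2) / ∑ m, x m ^ 2 := by
  have h1 := regInvNorm_sq_mul_sum_sq_le_one hε x
  have h2 := regInvNorm_sq_le hε hx
  set r := regInvNorm ε x
  set c := ∑ k, x k * d k
  have e : ∑ m, (r * d m - r ^ 3 * c * x m) ^ 2
      = r ^ 2 * ∑ m, d m ^ 2 - 2 * r ^ 4 * c ^ 2 + r ^ 4 * c ^ 2 * (r ^ 2 * ∑ m, x m ^ 2) := by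
    have : ∀ m, (r * d m - r ^ 3 * c * x m) ^ 2
        = r ^ 2 * d m ^ 2 - 2 * r ^ 4 * c * (x m * d m) + r ^ 6 * c ^ 2 * x m ^ 2 := fun m => by ring
    simp only [this, Finset.sum_add_distrib, Finset.sum_sub_distrib, ← Finset.mul_sum]
    ring
  rw [e, div_eq_inv_mul]
  have h3 : r ^ 4 * c ^ 2 * (r ^ 2 * ∑ m, x m ^ 2) ≤ r ^ 4 * c ^ 2 :=
    mul_le_of_le_one_right (by positivity) h1
  have h4 : r ^ 2 * ∑ m, d m ^ 2 ≤ (∑ m, x m ^ 2)⁻¹ * ∑ m, d m ^ 2 := by gcongr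
  have h5 : 0 ≤ r ^ 4 * c ^ 2 := by positivity
  linarith

lemma sq_regInvNorm_log_deriv_le (hε : 0 < ε) {x : Fin q → ℝ} (hx : 0 < ∑ m, x m ^ 2)
    (d : Fin q → ℝ) :
    (regInvNorm ε x ^ 2 * ∑ k, x k * d k) ^ 2 ≤ (∑ m, d m ^ 2) / ∑ m, x m ^ 2 := by
  have h1 := regInvNorm_sq_mul_sum_sq_le_one hε x
  have h2 := regInvNorm_sq_le hε hx
  have h3 := Finset.sum_mul_sq_le_sq_mul_sq Finset.univ x d
  set r := regInvNorm ε x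
  calc _ ≤ (r ^ 2) ^ 2 * ((∑ m, x m ^ 2) * ∑ m, d m ^ 2) := by
        rw [mul_pow]
        gcongr
    _ = r ^ 2 * ((r ^ 2 * ∑ m, x m ^ 2) * ∑ m, d m ^ 2) := by ring
    _ ≤ (∑ m, x m ^ 2)⁻¹ * (1 * ∑ m, d m ^ 2) := by gcongr
    _ = _ := by rw [one_mul, div_eq_inv_mul]

end RegInvNorm

/-- Regularised normalisation `x / √(‖x‖² + ε)`. -/
def regNormalize {q : ℕ} (ε : ℝ) (x : Fin q → ℝ) : Fin q → ℝ := fun m => regInvNorm ε x * x m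

lemma sum_sq_regNormalize_le_one {q : ℕ} {ε : ℝ} (hε : 0 < ε) (x : Fin q → ℝ) :
    ∑ m, regNormalize ε x m ^ 2 ≤ 1 := by
  simpa [regNormalize, mul_pow, Finset.mul_sum] using regInvNorm_sq_mul_sum_sq_le_one hε x

lemma contDiff_regNormalize {q : ℕ} {ε : ℝ} (hε : 0 < ε) :
    ContDiff ℝ 1 (regNormalize (q := q) ε) :=
  contDiff_pi.2 fun m => (contDiff_regInvNorm hε).mul (contDiff_apply ℝ ℝ m)

lemma hasFDerivAt_regNormalize_comp {E : Type*} [NormedAddCommGroup E] [NormedSpace ℝ E] {q : ℕ}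
    {ε : ℝ} (hε : 0 < ε) {h : E → Fin q → ℝ} {h' : E →L[ℝ] Fin q → ℝ} {z : E}
    (hh : HasFDerivAt h h' z) :
    ∃ u' : E →L[ℝ] Fin q → ℝ, HasFDerivAt (fun z => regNormalize ε (h z)) u' z ∧
      ∀ y m, u' y m = regInvNorm ε (h z) * h' y m
        - regInvNorm ε (h z) ^ 3 * (∑ k, h z k * h' y k) * h z m := by
  have hm : ∀ m, HasFDerivAt (fun z => h z m)
      ((ContinuousLinearMap.proj (R := ℝ) (φ := fun _ : Fin q => ℝ) m).comp h') z :=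
    hasFDerivAt_pi'.1 hh
  refine ⟨_, hasFDerivAt_pi.2 fun m => (hasFDerivAt_regInvNorm_comp hε hh).mul (hm m),
    fun y m => ?_⟩
  simp only [ContinuousLinearMap.coe_pi', _root_.add_apply, _root_.smul_apply, _root_.sum_apply,
    ContinuousLinearMap.comp_apply, ContinuousLinearMap.proj_apply, smul_eq_mul]
  ring

/-- The entries of `-(Z f) gᵀ`. -/
def bilinField {n q : ℕ} (f g : (Fin n → Fin q → ℝ) → Fin q → ℝ) (p : Fin n × Fin q)
    (z : Fin n → Fin q → ℝ) : ℝ := -(∑ m, z p.1 m * f z m) * g z p.2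

section BilinField

variable {n q : ℕ} {f g : (Fin n → Fin q → ℝ) → Fin q → ℝ}

lemma locallyLipschitz_bilinField (hf : LocallyLipschitz f) (hg : LocallyLipschitz g)
    (p : Fin n × Fin q) : LocallyLipschitz (bilinField f g p) := by
  have hc : ContDiff ℝ 1 fun y : (Fin n → Fin q → ℝ) × (Fin q → ℝ) × (Fin q → ℝ) =>
      -(∑ m, y.1 p.1 m * y.2.1 m) * y.2.2 p.2 := by fun_prop
  have hl := hc.locallyLipschitz
  have hp : LocallyLipschitz fun z => (z, f z, g z) := LocallyLipschitz.id.prodMk (hf.prodMk hg)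
  have hlp := hl.comp hp
  unfold bilinField
  exact hlp

lemma fderiv_bilinField {f' g' : (Fin n → Fin q → ℝ) →L[ℝ] Fin q → ℝ} {z : Fin n → Fin q → ℝ}
    (hf : HasFDerivAt f f' z) (hg : HasFDerivAt g g' z) (p p' : Fin n × Fin q) :
    fderiv ℝ (bilinField f g p) z (Pi.single p'.1 (Pi.single p'.2 1))
      = -(((if p.1 = p'.1 then f z p'.2 else 0)
          + ∑ m, z p.1 m * f' (Pi.single p'.1 (Pi.single p'.2 1)) m) * g z p.2
        + (∑ m, z p.1 m * f z m) * g' (Pi.single p'.1 (Pi.single p'.2 1)) p.2) := by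
  have hfm : ∀ m, HasFDerivAt (fun z => f z m)
      ((ContinuousLinearMap.proj (R := ℝ) (φ := fun _ : Fin q => ℝ) m).comp f') z :=
    hasFDerivAt_pi'.1 hf
  have hgm : ∀ m, HasFDerivAt (fun z => g z m)
      ((ContinuousLinearMap.proj (R := ℝ) (φ := fun _ : Fin q => ℝ) m).comp g') z :=
    hasFDerivAt_pi'.1 hg
  have hF : HasFDerivAt (bilinField f g p) _ z :=
    ((HasFDerivAt.fun_sum fun m (_ : m ∈ Finset.univ) =>
      (entryCLM (p.1, m)).hasFDerivAt.mul (hfm m)).neg).mul (hgm p.2)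
  rw [hF.fderiv]
  simp only [_root_.add_apply, _root_.smul_apply, _root_.sum_apply, _root_.neg_apply,
    ContinuousLinearMap.comp_apply, ContinuousLinearMap.proj_apply, smul_eq_mul, entryCLM_apply,
    single_single_apply, Finset.sum_add_distrib, Pi.neg_apply, Pi.mul_apply]
  have e : ∑ m, f z m * (if (p.1, m) = (p'.1, p'.2) then (1 : ℝ) else 0)
      = if p.1 = p'.1 then f z p'.2 else 0 := by
    by_cases h : p.1 = p'.1 <;> simp [h, Prod.ext_iff]
  rw [e]
  ring

end BilinField

/-- Squared Frobenius norm of the Jacobian of `h` in the rows `J`, relative to `‖h‖²`. -/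
def relJacobianSq {n q : ℕ} (J : Finset (Fin n)) (h : (Fin n → Fin q → ℝ) → Fin q → ℝ)
    (z : Fin n → Fin q → ℝ) : ℝ :=
  ∑ i ∈ J, ∑ j, (∑ j', fderiv ℝ h z (Pi.single i (Pi.single j 1)) j' ^ 2) / (∑ j', h z j' ^ 2)

lemma relJacobianSq_nonneg {n q : ℕ} (J : Finset (Fin n)) (h : (Fin n → Fin q → ℝ) → Fin q → ℝ)
    (z : Fin n → Fin q → ℝ) : 0 ≤ relJacobianSq J h z := by
  unfold relJacobianSq
  positivity

lemma relJacobianSq_eq_sum_product {n q : ℕ} (J : Finset (Fin n))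
    (h : (Fin n → Fin q → ℝ) → Fin q → ℝ) (z : Fin n → Fin q → ℝ) :
    relJacobianSq J h z = ∑ p ∈ J ×ˢ Finset.univ,
      (∑ j', fderiv ℝ h z (Pi.single p.1 (Pi.single p.2 1)) j' ^ 2) / (∑ j', h z j' ^ 2) := by
  rw [Finset.sum_product]
  rfl

section RegularisedField

variable {n q : ℕ} {ε : ℝ} {h ht : (Fin n → Fin q → ℝ) → Fin q → ℝ} {z : Fin n → Fin q → ℝ}
  {K : ℝ} {J : Finset (Fin n)}

lemma sum_sq_bilinField_le {f g : (Fin n → Fin q → ℝ) → Fin q → ℝ}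
    (hK : ∀ x : Fin q → ℝ, ∑ i ∈ J, (∑ m, z i m * x m) ^ 2 ≤ K * ∑ m, x m ^ 2) (hK0 : 0 ≤ K)
    (hf : ∑ m, f z m ^ 2 ≤ 1) (hg : ∑ m, g z m ^ 2 ≤ 1) :
    ∑ p ∈ J ×ˢ Finset.univ, bilinField f g p z ^ 2 ≤ K := by
  calc _ = (∑ i ∈ J, (∑ m, z i m * f z m) ^ 2) * ∑ m, g z m ^ 2 := by
        simp only [bilinField, Finset.sum_product, mul_pow, neg_sq, Finset.sum_mul_sum]
    _ ≤ ∑ i ∈ J, (∑ m, z i m * f z m) ^ 2 :=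
        mul_le_of_le_one_right (Finset.sum_nonneg fun i _ => sq_nonneg _) hg
    _ ≤ K := (hK _).trans (mul_le_of_le_one_right hK0 hf)

lemma sum_sq_fderiv_bilinField_regNormalize_le (hε : 0 < ε)
    (hK : ∀ x : Fin q → ℝ, ∑ i ∈ J, (∑ m, z i m * x m) ^ 2 ≤ K * ∑ m, x m ^ 2) (hK0 : 0 ≤ K)
    (hd : DifferentiableAt ℝ h z) (htd : DifferentiableAt ℝ ht z)
    (hpos : 0 < ∑ m, h z m ^ 2) (htpos : 0 < ∑ m, ht z m ^ 2) :
    ∑ p ∈ J ×ˢ Finset.univ, ∑ p' ∈ J ×ˢ Finset.univ,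
      fderiv ℝ (bilinField (fun z => regNormalize ε (h z)) (fun z => regNormalize ε (ht z)) p) z
        (Pi.single p'.1 (Pi.single p'.2 1)) ^ 2
      ≤ 3 * (J.card + K * relJacobianSq J h z + K * relJacobianSq J ht z) := by
  obtain ⟨u', hu', hu⟩ := hasFDerivAt_regNormalize_comp hε hd.hasFDerivAt
  obtain ⟨v', hv', hv⟩ := hasFDerivAt_regNormalize_comp hε htd.hasFDerivAt
  simp only [fderiv_bilinField hu' hv', neg_sq]
  refine (sum_sq_jacobian_le J z hK hK0 (sum_sq_regNormalize_le_one hε (h z))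
    (sum_sq_regNormalize_le_one hε (ht z))
    (fun p => u' (Pi.single p.1 (Pi.single p.2 1)))
    (fun p => v' (Pi.single p.1 (Pi.single p.2 1)))).trans ?_
  rw [relJacobianSq_eq_sum_product, relJacobianSq_eq_sum_product]
  gcongr with p _ p _
  · simp only [hu]
    exact sum_sq_regInvNorm_deriv_le hε hpos _
  · simp only [hv]
    exact sum_sq_regInvNorm_deriv_le hε htpos _

/-- `rᵀ L_J r̃ + ∑ ∂(r_i h̃_j)/∂z_ij`. -/
def bilinResidual (J : Finset (Fin n)) (h ht : (Fin n → Fin q → ℝ) → Fin q → ℝ)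
    (z : Fin n → Fin q → ℝ) : ℝ :=
  (∑ i ∈ J, (-∑ j, z i j * h z j) * (-∑ j, z i j * ht z j)) +
    ∑ i ∈ J, ∑ j, fderiv ℝ (fun z' => (-∑ j, z' i j * h z' j) * ht z' j) z
      (Pi.single i (Pi.single j 1))

lemma sq_bilinResidual_le (hε : 0 < ε)
    (hK : ∀ x : Fin q → ℝ, ∑ i ∈ J, (∑ m, z i m * x m) ^ 2 ≤ K * ∑ m, x m ^ 2) (hK0 : 0 ≤ K)
    (hd : DifferentiableAt ℝ h z) (htd : DifferentiableAt ℝ ht z)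
    (hpos : 0 < ∑ m, h z m ^ 2) (htpos : 0 < ∑ m, ht z m ^ 2) :
    (regInvNorm ε (h z) * regInvNorm ε (ht z) * bilinResidual J h ht z) ^ 2
      ≤ 2 * (∑ p ∈ J ×ˢ Finset.univ, (z p.1 p.2 *
            bilinField (fun z => regNormalize ε (h z)) (fun z => regNormalize ε (ht z)) p z
          - fderiv ℝ (bilinField (fun z => regNormalize ε (h z))
              (fun z => regNormalize ε (ht z)) p) z (Pi.single p.1 (Pi.single p.2 1)))) ^ 2
        + 4 * (K * (relJacobianSq J h z + relJacobianSq J ht z)) := by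
  obtain ⟨u', hu', hu⟩ := hasFDerivAt_regNormalize_comp hε hd.hasFDerivAt
  obtain ⟨v', hv', hv⟩ := hasFDerivAt_regNormalize_comp hε htd.hasFDerivAt
  set F := bilinField (fun z => regNormalize ε (h z)) (fun z => regNormalize ε (ht z)) with hF
  set a : Fin n × Fin q → ℝ := fun p => regInvNorm ε (h z) ^ 2 *
    ∑ k, h z k * fderiv ℝ h z (Pi.single p.1 (Pi.single p.2 1)) k with ha
  set b : Fin n × Fin q → ℝ := fun p => regInvNorm ε (ht z) ^ 2 *
    ∑ k, ht z k * fderiv ℝ ht z (Pi.single p.1 (Pi.single p.2 1)) k with hb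
  have hQ : regInvNorm ε (h z) * regInvNorm ε (ht z) * bilinResidual J h ht z
      = -(∑ p ∈ J ×ˢ Finset.univ,
          (z p.1 p.2 * F p z - fderiv ℝ (F p) z (Pi.single p.1 (Pi.single p.2 1))))
        + ∑ p ∈ J ×ˢ Finset.univ, F p z * (a p + b p) := by
    have e : bilinResidual J h ht z = ∑ p ∈ J ×ˢ Finset.univ,
        (-(z p.1 p.2 * bilinField h ht p z)
          + fderiv ℝ (bilinField h ht p) z (Pi.single p.1 (Pi.single p.2 1))) := by
      rw [Finset.sum_add_distrib, Finset.sum_product, Finset.sum_product]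
      refine congrArg₂ (· + ·) (Finset.sum_congr rfl fun i _ => ?_) rfl
      rw [neg_mul_neg, Finset.mul_sum]
      exact Finset.sum_congr rfl fun j _ => by simp only [bilinField]; ring
    rw [e, Finset.mul_sum, ← Finset.sum_neg_distrib, ← Finset.sum_add_distrib]
    refine Finset.sum_congr rfl fun p _ => ?_
    rw [hF, fderiv_bilinField hu' hv', fderiv_bilinField hd.hasFDerivAt htd.hasFDerivAt]
    simp only [hu, hv, ha, hb, bilinField, regNormalize, if_true, mul_sub, Finset.sum_sub_distrib,
      mul_left_comm (z _ _), ← Finset.mul_sum]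
    ring
  have hextra : (∑ p ∈ J ×ˢ Finset.univ, F p z * (a p + b p)) ^ 2
      ≤ 2 * (K * (relJacobianSq J h z + relJacobianSq J ht z)) := by
    refine (Finset.sum_mul_sq_le_sq_mul_sq _ _ _).trans ?_
    rw [mul_left_comm]
    refine mul_le_mul (sum_sq_bilinField_le hK hK0 (sum_sq_regNormalize_le_one hε (h z))
      (sum_sq_regNormalize_le_one hε (ht z))) ?_ (Finset.sum_nonneg fun p _ => sq_nonneg _) hK0
    rw [relJacobianSq_eq_sum_product, relJacobianSq_eq_sum_product, ← Finset.sum_add_distrib,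
      Finset.mul_sum]
    refine Finset.sum_le_sum fun p _ => add_sq_le.trans ?_
    gcongr
    · exact sq_regInvNorm_log_deriv_le hε hpos _
    · exact sq_regInvNorm_log_deriv_le hε htpos _
  rw [hQ]
  have := add_sq_le (a := -(∑ p ∈ J ×ˢ Finset.univ,
    (z p.1 p.2 * F p z - fderiv ℝ (F p) z (Pi.single p.1 (Pi.single p.2 1)))))
    (b := ∑ p ∈ J ×ˢ Finset.univ, F p z * (a p + b p))
  rw [neg_sq] at this
  linarith

end RegularisedField

section SteinBilinear

variable {n q : ℕ} {h ht : (Fin n → Fin q → ℝ) → Fin q → ℝ}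

lemma sum_sq_pos_of_ne_zero {x : Fin q → ℝ} (hx : x ≠ 0) : 0 < ∑ m, x m ^ 2 := by
  obtain ⟨m, hm⟩ := Function.ne_iff.1 hx
  exact Finset.sum_pos' (fun _ _ => sq_nonneg _) ⟨m, Finset.mem_univ m, sq_pos_of_ne_zero hm⟩

lemma ae_differentiableAt_stdGaussMat (hh : LocallyLipschitz h) :
    ∀ᵐ z ∂stdGaussMat n q, DifferentiableAt ℝ h z :=
  (stdGaussMat_absolutelyContinuous n q).ae_le hh.ae_differentiableAt

lemma measurable_bilinResidual (J : Finset (Fin n)) (hh : LocallyLipschitz h)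
    (hht : LocallyLipschitz ht) : Measurable (bilinResidual J h ht) := by
  have h1 := hh.continuous
  have h2 := hht.continuous
  refine Measurable.add (Continuous.measurable (by fun_prop)) ?_
  exact Finset.measurable_sum _ fun i _ => Finset.measurable_sum _ fun j _ =>
    measurable_fderiv_apply_const ℝ _ _

lemma lintegral_sq_regularised_bilinResidual_le (J : Finset (Fin n)) {ε : ℝ} (hε : 0 < ε)
    (hh : LocallyLipschitz h) (hht : LocallyLipschitz ht)
    (hne : ∀ᵐ z ∂stdGaussMat n q, h z ≠ 0) (htne : ∀ᵐ z ∂stdGaussMat n q, ht z ≠ 0) :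
    ∫⁻ z, ENNReal.ofReal ((regInvNorm ε (h z) * regInvNorm ε (ht z)
        * bilinResidual J h ht z) ^ 2) ∂stdGaussMat n q
      ≤ ENNReal.ofReal 16 * ((J.card : ℝ≥0∞) + ∫⁻ z, ENNReal.ofReal
          (matOpNorm (Matrix.of fun i j => if i ∈ J then z i j else 0) ^ 2 *
            (1 + relJacobianSq J h z + relJacobianSq J ht z)) ∂stdGaussMat n q) := by
  set M : (Fin n → Fin q → ℝ) → ℝ := fun z =>
    matOpNorm (Matrix.of fun i j => if i ∈ J then z i j else 0) ^ 2 *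
      (1 + relJacobianSq J h z + relJacobianSq J ht z) with hM
  set F := bilinField (fun z => regNormalize ε (h z)) (fun z => regNormalize ε (ht z)) with hF
  have hN : ∀ {f : (Fin n → Fin q → ℝ) → Fin q → ℝ}, LocallyLipschitz f →
      LocallyLipschitz fun z => regNormalize ε (f z) := fun hf =>
    (contDiff_regNormalize hε).locallyLipschitz.comp hf
  have hFl : ∀ p, LocallyLipschitz (F p) := locallyLipschitz_bilinField (hN hh) (hN hht)
  have hgood : ∀ᵐ z ∂stdGaussMat n q, DifferentiableAt ℝ h z ∧ DifferentiableAt ℝ ht z ∧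
      0 < ∑ m, h z m ^ 2 ∧ 0 < ∑ m, ht z m ^ 2 := by
    filter_upwards [ae_differentiableAt_stdGaussMat hh, ae_differentiableAt_stdGaussMat hht,
      hne, htne] with z h1 h2 h3 h4
    exact ⟨h1, h2, sum_sq_pos_of_ne_zero h3, sum_sq_pos_of_ne_zero h4⟩
  set D : (Fin n → Fin q → ℝ) → ℝ := fun z => ∑ p ∈ J ×ˢ Finset.univ,
    (z p.1 p.2 * F p z - fderiv ℝ (F p) z (Pi.single p.1 (Pi.single p.2 1))) with hD
  have hDm : Measurable D := Finset.measurable_sum _ fun p _ =>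
    (Continuous.measurable (by have := (hFl p).continuous; fun_prop)).sub
      (measurable_fderiv_apply_const ℝ _ _)
  have hM0 : ∀ z, 0 ≤ M z := fun z => by
    have := relJacobianSq_nonneg J h z
    have := relJacobianSq_nonneg J ht z
    positivity
  have hstein : ∫⁻ z, ENNReal.ofReal (D z ^ 2) ∂stdGaussMat n q
      ≤ 6 * (J.card : ℝ≥0∞) + 6 * ∫⁻ z, ENNReal.ofReal (M z) ∂stdGaussMat n q := by
    calc _ ≤ _ := lintegral_stein_sq_stdGaussMat_le (J ×ˢ Finset.univ) hFl
      _ ≤ ∫⁻ z, (6 * (J.card : ℝ≥0∞) + 6 * ENNReal.ofReal (M z)) ∂stdGaussMat n q := by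
          refine lintegral_mono_ae ?_
          filter_upwards [hgood] with z ⟨h1, h2, h3, h4⟩
          have hK0 := sq_nonneg (matOpNorm (Matrix.of fun i j => if i ∈ J then z i j else 0))
          have hK := sum_sq_row_le_matOpNorm J z
          have e1 := sum_sq_bilinField_le (f := fun z => regNormalize ε (h z))
            (g := fun z => regNormalize ε (ht z)) hK hK0
            (sum_sq_regNormalize_le_one hε (h z)) (sum_sq_regNormalize_le_one hε (ht z))
          have e2 := sum_sq_fderiv_bilinField_regNormalize_le hε hK hK0 h1 h2 h3 h4
          have e3 : (6 : ℝ≥0∞) * (J.card : ℝ≥0∞) + 6 * ENNReal.ofReal (M z)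
              = ENNReal.ofReal (6 * J.card + 6 * M z) := by
            rw [ENNReal.ofReal_add (by positivity) (mul_nonneg (by norm_num) (hM0 z)),
              ENNReal.ofReal_mul (p := 6) (by norm_num),
              ENNReal.ofReal_mul (p := 6) (by norm_num)]
            simp
          rw [e3]
          refine ENNReal.ofReal_le_ofReal ?_
          simp only [hM]
          linarith
      _ = _ := by
          rw [lintegral_add_left measurable_const, lintegral_const,
            lintegral_const_mul' _ _ (by simp)]
          simp
  calc _ ≤ ∫⁻ z, (2 * ENNReal.ofReal (D z ^ 2) + 4 * ENNReal.ofReal (M z)) ∂stdGaussMat n q := by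
        refine lintegral_mono_ae ?_
        filter_upwards [hgood] with z ⟨h1, h2, h3, h4⟩
        have hK0 := sq_nonneg (matOpNorm (Matrix.of fun i j => if i ∈ J then z i j else 0))
        have e1 := sq_bilinResidual_le hε (sum_sq_row_le_matOpNorm J z) hK0 h1 h2 h3 h4
        have e3 : (2 : ℝ≥0∞) * ENNReal.ofReal (D z ^ 2) + 4 * ENNReal.ofReal (M z)
            = ENNReal.ofReal (2 * D z ^ 2 + 4 * M z) := by
          rw [ENNReal.ofReal_add (by positivity) (mul_nonneg (by norm_num) (hM0 z)),
            ENNReal.ofReal_mul (p := 2) (by norm_num),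
            ENNReal.ofReal_mul (p := 4) (by norm_num)]
          simp
        rw [e3]
        refine ENNReal.ofReal_le_ofReal (e1.trans ?_)
        simp only [hM, hD, hF]
        linarith
    _ = 2 * ∫⁻ z, ENNReal.ofReal (D z ^ 2) ∂stdGaussMat n q
        + 4 * ∫⁻ z, ENNReal.ofReal (M z) ∂stdGaussMat n q := by
        rw [lintegral_add_left ((hDm.pow_const 2).ennreal_ofReal.const_mul _),
          lintegral_const_mul' _ _ (by simp), lintegral_const_mul' _ _ (by simp)]
    _ ≤ 2 * (6 * (J.card : ℝ≥0∞) + 6 * ∫⁻ z, ENNReal.ofReal (M z) ∂stdGaussMat n q)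
        + 4 * ∫⁻ z, ENNReal.ofReal (M z) ∂stdGaussMat n q := by gcongr
    _ = 12 * (J.card : ℝ≥0∞) + 16 * ∫⁻ z, ENNReal.ofReal (M z) ∂stdGaussMat n q := by ring
    _ ≤ 16 * (J.card : ℝ≥0∞) + 16 * ∫⁻ z, ENNReal.ofReal (M z) ∂stdGaussMat n q := by
        gcongr
        norm_num
    _ = _ := by
        rw [mul_add, ENNReal.ofReal_ofNat]

lemma lintegral_sq_bilinResidual_div_le (J : Finset (Fin n))
    (hh : LocallyLipschitz h) (hht : LocallyLipschitz ht)
    (hne : ∀ᵐ z ∂stdGaussMat n q, h z ≠ 0) (htne : ∀ᵐ z ∂stdGaussMat n q, ht z ≠ 0) :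
    ∫⁻ z, ENNReal.ofReal (bilinResidual J h ht z ^ 2 /
        ((∑ m, h z m ^ 2) * ∑ m, ht z m ^ 2)) ∂stdGaussMat n q
      ≤ ENNReal.ofReal 16 * ((J.card : ℝ≥0∞) + ∫⁻ z, ENNReal.ofReal
          (matOpNorm (Matrix.of fun i j => if i ∈ J then z i j else 0) ^ 2 *
            (1 + relJacobianSq J h z + relJacobianSq J ht z)) ∂stdGaussMat n q) := by
  have hε : ∀ k : ℕ, (0 : ℝ) < 1 / (k + 1) := fun k => by positivity
  refine lintegral_le_of_ae_tendsto (f := fun k z => ENNReal.ofReal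
    ((regInvNorm (1 / (k + 1)) (h z) * regInvNorm (1 / (k + 1)) (ht z)
        * bilinResidual J h ht z) ^ 2)) (fun k => ?_) ?_
    (Filter.Eventually.of_forall fun k =>
      lintegral_sq_regularised_bilinResidual_le J (hε k) hh hht hne htne)
  · have hc := (contDiff_regInvNorm (q := q) (hε k)).continuous
    have h1 := (hc.comp hh.continuous).measurable
    have h2 := (hc.comp hht.continuous).measurable
    exact (((h1.mul h2).mul (measurable_bilinResidual J hh hht)).pow_const 2).ennreal_ofReal
  · filter_upwards [hne, htne] with z hz htz
    have hlim : ∀ x : Fin q → ℝ, x ≠ 0 → Filter.Tendsto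
        (fun k : ℕ => regInvNorm (1 / ((k : ℝ) + 1)) x ^ 2) Filter.atTop
        (nhds (∑ m, x m ^ 2)⁻¹) := fun x hx => by
      simp only [regInvNorm_sq (hε _)]
      simpa using (tendsto_one_div_add_atTop_nhds_zero_nat.const_add (∑ m, x m ^ 2)).inv₀
        (by simpa using (sum_sq_pos_of_ne_zero hx).ne')
    refine (ENNReal.continuous_ofReal.tendsto _).comp ?_
    have := ((hlim _ hz).mul (hlim _ htz)).mul_const (bilinResidual J h ht z ^ 2)
    rw [← mul_inv, inv_mul_eq_div] at this
    simpa only [mul_pow] using this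

end SteinBilinear

/-- **Second-order Stein bound for bilinear residual forms** (Lemma A.2, variant of
Proposition 6.1 of Bellec–Zhang). There is an absolute constant `C > 0` such that for
any locally Lipschitz `h, h̃ : ℝ^{n×q} → ℝ^q`, nonzero almost surely, with
`r = −Zh`, `r̃ = −Zh̃`, and any fixed `J ⊆ {1,…,n}`,
`E[‖h‖⁻²‖h̃‖⁻² (rᵀL_J r̃ + ∑_{i∈J}∑_j ∂(r_i h̃_j)/∂z_{ij})²]
  ≤ C (|J| + E[‖L_J Z‖_op² (1 + Ξ_J + Ξ̃_J)])`. -/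
theorem stein_bilinear_bound :
    ∃ C : ℝ, 0 < C ∧
      ∀ (n q : ℕ) (_hn : 0 < n) (_hq : 0 < q)
        (h ht : (Fin n → Fin q → ℝ) → Fin q → ℝ)
        (_hlip : LocallyLipschitz h) (_htlip : LocallyLipschitz ht)
        (_hne : ∀ᵐ z ∂ stdGaussMat n q, h z ≠ 0)
        (_htne : ∀ᵐ z ∂ stdGaussMat n q, ht z ≠ 0)
        (J : Finset (Fin n)),
        (let r : (Fin n → Fin q → ℝ) → Fin n → ℝ := fun z i => -∑ j, z i j * h z j
         let rt : (Fin n → Fin q → ℝ) → Fin n → ℝ := fun z i => -∑ j, z i j * ht z j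
         let Ξ : (Fin n → Fin q → ℝ) → ℝ := fun z =>
           ∑ i ∈ J, ∑ j,
             (∑ j', fderiv ℝ h z (Pi.single i (Pi.single j 1)) j' ^ 2) /
               (∑ j', h z j' ^ 2)
         let Ξt : (Fin n → Fin q → ℝ) → ℝ := fun z =>
           ∑ i ∈ J, ∑ j,
             (∑ j', fderiv ℝ ht z (Pi.single i (Pi.single j 1)) j' ^ 2) /
               (∑ j', ht z j' ^ 2)
         (∫⁻ z, ENNReal.ofReal
             (((∑ i ∈ J, r z i * rt z i) +
                 ∑ i ∈ J, ∑ j,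
                   fderiv ℝ (fun z' => r z' i * ht z' j) z
                     (Pi.single i (Pi.single j 1))) ^ 2 /
               ((∑ j', h z j' ^ 2) * (∑ j', ht z j' ^ 2)))
           ∂ stdGaussMat n q)
         ≤ ENNReal.ofReal C *
             ((J.card : ℝ≥0∞) +
               ∫⁻ z, ENNReal.ofReal
                   (matOpNorm (Matrix.of fun i j => if i ∈ J then z i j else 0) ^ 2 *
                     (1 + Ξ z + Ξt z))
                 ∂ stdGaussMat n q)) := by
  refine ⟨16, by norm_num, fun n q _ _ h ht hh hht hne htne J => ?_⟩
  exact lintegral_sq_bilinResidual_div_le J hh hht hne htne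

end
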